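/- Let φ: (R, m) → (S, n) be a local ring homomorphism of commutative noetherian local rings such that S has finite flat dimension as an R-module via φ (i.e., S admits a bounded resolution by flat R-modules). If S is Gorenstein, then R is Gorenstein. -/

import Mathlib

/-!
STATEMENT 2: If φ: (R,m) → (S,n) is a local homomorphism of commutative noetherian
local rings such that S has finite flat dimension as an R-module, and S is
Gorenstein, then R is Gorenstein.
-/

open CategoryTheory

/-- `Ext^i_R(M, N)` for `R`-modules `M`, `N`. -/
noncomputable def extMod (R : Type) [CommRing R] (M N : ModuleCat R) (i : ℕ) : ModuleCat R :=
  ((Ext R (ModuleCat R) i).obj (Opposite.op M)).obj N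

/-- `Tor_i^R(M, N)` for `R`-modules `M`, `N`. -/
noncomputable def torMod (R : Type) [CommRing R] (M N : ModuleCat R) (i : ℕ) : ModuleCat R :=
  ((Tor (ModuleCat R) i).obj M).obj N

/-- A commutative ring is Gorenstein if it has finite injective dimension over itself. -/
def IsGorenstein (R : Type) [CommRing R] : Prop :=
  ∃ n : ℕ, ∀ (M : ModuleCat R) (i : ℕ), n < i → Subsingleton (extMod R M (ModuleCat.of R R) i)

/-- An `R`-module `N` has finite flat dimension, i.e. a bounded resolution by flat
`R`-modules; equivalently, `Tor_i^R(M, N) = 0` for all `M` and all `i` greater than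
some fixed `n`. -/
def HasFiniteFlatDimension (R : Type) [CommRing R] (N : ModuleCat R) : Prop :=
  ∃ n : ℕ, ∀ (M : ModuleCat R) (i : ℕ), n < i → Subsingleton (torMod R M N i)

/-- `M` has a flat resolution of length at most `n`. -/
def FlatDimLE (R : Type) [CommRing R] : ℕ → ∀ (M : Type) [AddCommGroup M] [Module R M], Prop
  | 0, M, _, _ => Module.Flat R M
  | n + 1, M, _, _ => ∃ (M' Q : ModuleCat.{0} R) (u : M' →ₗ[R] Q) (v : Q →ₗ[R] M),
      Module.Flat R Q ∧ Function.Injective u ∧ Function.Exact u v ∧ Function.Surjective v ∧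
        FlatDimLE R n M'

section Flat

variable {R : Type} [CommRing R]

lemma rTensor_lTensor_comm {A B P Q : Type*} [AddCommGroup A] [Module R A] [AddCommGroup B]
    [Module R B] [AddCommGroup P] [Module R P] [AddCommGroup Q] [Module R Q]
    (f : A →ₗ[R] B) (g : P →ₗ[R] Q) (x : TensorProduct R A P) :
    f.rTensor Q (g.lTensor A x) = g.lTensor B (f.rTensor P x) := by
  rw [← LinearMap.comp_apply, ← LinearMap.comp_apply, LinearMap.rTensor_comp_lTensor,
    LinearMap.lTensor_comp_rTensor]

/-- Tensoring an exact complex of flat modules with a module of flat dimension at most `n`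
preserves exactness in degrees greater than `n`. -/
lemma FlatDimLE.exact_rTensor {F : ℕ → Type} [∀ q, AddCommGroup (F q)] [∀ q, Module R (F q)]
    [∀ q, Module.Flat R (F q)] (d : ∀ q, F (q + 1) →ₗ[R] F q)
    (hd : ∀ q, Function.Exact (d (q + 1)) (d q)) (n : ℕ) (M : Type) [AddCommGroup M] [Module R M]
    (hM : FlatDimLE R n M) (q : ℕ) (hq : n ≤ q) :
    Function.Exact ((d (q + 1)).rTensor M) ((d q).rTensor M) := by
  induction n generalizing M q with
  | zero =>
    have : Module.Flat R M := hM
    exact Module.Flat.rTensor_exact M (hd q)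
  | succ n ih =>
    obtain ⟨M', Q, u, v, _, hu, huv, hv, hM'⟩ := hM
    obtain ⟨q, rfl⟩ : ∃ p, q = p + 1 := ⟨q - 1, by omega⟩
    have hdd : ∀ q (N : Type) [AddCommGroup N] [Module R N] (x),
        (d q).rTensor N ((d (q + 1)).rTensor N x) = 0 := fun q N _ _ x ↦ by
      rw [← LinearMap.comp_apply, ← LinearMap.rTensor_comp, (hd q).linearMap_comp_eq_zero,
        LinearMap.rTensor_zero, LinearMap.zero_apply]
    intro x
    refine ⟨fun hx ↦ ?_, ?_⟩
    · obtain ⟨x, rfl⟩ := LinearMap.lTensor_surjective _ hv x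
      rw [rTensor_lTensor_comm] at hx
      obtain ⟨z, hz⟩ := (lTensor_exact _ huv hv _).1 hx
      have hz0 : (d q).rTensor M' z = 0 := by
        apply Module.Flat.lTensor_preserves_injective_linearMap (M := F q) u hu
        rw [← rTensor_lTensor_comm, hz, hdd, map_zero]
      obtain ⟨w, rfl⟩ := (ih M' hM' q (by omega) z).1 hz0
      have h : (d (q + 1)).rTensor Q (x - u.lTensor _ w) = 0 := by
        rw [map_sub, rTensor_lTensor_comm, hz, sub_self]
      obtain ⟨t, ht⟩ := (Module.Flat.rTensor_exact Q (hd (q + 1)) _).1 h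
      refine ⟨v.lTensor _ t, ?_⟩
      rw [rTensor_lTensor_comm, ht, map_sub, sub_eq_self]
      exact (lTensor_exact _ huv hv _).2 ⟨w, rfl⟩
    · rintro ⟨y, rfl⟩
      exact hdd _ _ _

/-- A chain map from a complex of flat modules to an acyclic differential module maps cocycles to
coboundaries after tensoring with a module of finite flat dimension. -/
lemma FlatDimLE.exists_rTensor_eq {C : ℕ → Type} [∀ q, AddCommGroup (C q)] [∀ q, Module R (C q)]
    [∀ q, Module.Flat R (C q)] (d : ∀ q, C q →ₗ[R] C (q + 1))
    (hd : ∀ q, d (q + 1) ∘ₗ d q = 0) {X : Type} [AddCommGroup X] [Module R X] (D : X →ₗ[R] X)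
    (hD : Function.Exact D D) (g : ∀ q, C q →ₗ[R] X) (hg : ∀ q, D ∘ₗ g q = g (q + 1) ∘ₗ d q)
    (n : ℕ) (M : Type) [AddCommGroup M] [Module R M] (hM : FlatDimLE R n M) (q : ℕ)
    (x : TensorProduct R (C q) M) (hx : (d q).rTensor M x = 0) :
    ∃ y, D.rTensor M y = (g q).rTensor M x := by
  have hg' : ∀ q (N : Type) [AddCommGroup N] [Module R N] (x),
      D.rTensor N ((g q).rTensor N x) = (g (q + 1)).rTensor N ((d q).rTensor N x) :=
    fun q N _ _ x ↦ by
      rw [← LinearMap.comp_apply, ← LinearMap.rTensor_comp, hg, LinearMap.rTensor_comp,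
        LinearMap.comp_apply]
  induction n generalizing M q with
  | zero =>
    have : Module.Flat R M := hM
    refine (Module.Flat.rTensor_exact M hD _).1 ?_
    rw [hg', hx, map_zero]
  | succ n ih =>
    obtain ⟨M', Q, u, v, _, hu, huv, hv, hM'⟩ := hM
    obtain ⟨x, rfl⟩ := LinearMap.lTensor_surjective _ hv x
    rw [rTensor_lTensor_comm] at hx
    obtain ⟨z, hz⟩ := (lTensor_exact _ huv hv _).1 hx
    have hz0 : (d (q + 1)).rTensor M' z = 0 := by
      apply Module.Flat.lTensor_preserves_injective_linearMap (M := C (q + 2)) u hu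
      rw [← rTensor_lTensor_comm, hz, map_zero, ← LinearMap.comp_apply, ← LinearMap.rTensor_comp,
        hd, LinearMap.rTensor_zero, LinearMap.zero_apply]
    obtain ⟨y, hy⟩ := ih M' hM' _ z hz0
    have h : D.rTensor Q ((g q).rTensor Q x - u.lTensor _ y) = 0 := by
      rw [map_sub, rTensor_lTensor_comm, hy, hg', ← hz, rTensor_lTensor_comm, sub_self]
    obtain ⟨t, ht⟩ := (Module.Flat.rTensor_exact Q hD _).1 h
    refine ⟨v.lTensor _ t, ?_⟩
    rw [rTensor_lTensor_comm, ht, map_sub, rTensor_lTensor_comm, sub_eq_self]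
    exact (lTensor_exact _ huv hv _).2 ⟨y, rfl⟩

end Flat

/-- Acyclicity of a double complex (as a differential module) whose rows have their cohomology
concentrated in `J`. -/
lemma exists_sub_mem_of_rows {Y : ℕ → Type} [∀ b, AddCommGroup (Y b)] (δ : ∀ b, Y b →+ Y b)
    (l : ∀ b, Y b →+ Y (b + 1)) (J : ∀ b, AddSubgroup (Y b))
    (hl : ∀ b y, l (b + 1) (l b y) = 0)
    (hδl : ∀ b y, δ (b + 1) (l b y) = -l b (δ b y))
    (hJ : ∀ b y, δ b y ∈ J b → ∃ h, y - δ b h ∈ J b)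
    (hJl : ∀ b y, y ∈ J b → l b y ∈ J (b + 1))
    (f : ∀ b, Y b) (h₀ : δ 0 (f 0) ∈ J 0) (h₁ : ∀ b, l b (f b) + δ (b + 1) (f (b + 1)) ∈ J (b + 1)) :
    ∃ h : ∀ b, Y b, f 0 - δ 0 (h 0) ∈ J 0 ∧
      ∀ b, f (b + 1) - (l b (h b) + δ (b + 1) (h (b + 1))) ∈ J (b + 1) := by
  have step : ∀ b (h : {h : Y b // l b (f b - δ b h) ∈ J (b + 1)}),
      ∃ h' : {h : Y (b + 1) // l (b + 1) (f (b + 1) - δ (b + 1) h) ∈ J (b + 2)},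
        f (b + 1) - (l b h + δ (b + 1) h') ∈ J (b + 1) := by
    rintro b ⟨h, hh⟩
    have : δ (b + 1) (f (b + 1) - l b h) ∈ J (b + 1) := by
      have e : δ (b + 1) (f (b + 1) - l b h) =
          (l b (f b) + δ (b + 1) (f (b + 1))) - l b (f b - δ b h) := by
        simp only [map_sub, hδl]; abel
      rw [e]
      exact sub_mem (h₁ b) hh
    obtain ⟨h', hh'⟩ := hJ _ _ this
    rw [sub_sub] at hh'
    refine ⟨⟨h', ?_⟩, hh'⟩
    have := hJl _ _ hh'
    simpa only [map_sub, map_add, hl, zero_add] using this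
  obtain ⟨h0, hh0⟩ := hJ 0 _ h₀
  choose s hs using step
  let h : ∀ b, {h : Y b // l b (f b - δ b h) ∈ J (b + 1)} :=
    fun b ↦ Nat.rec ⟨h0, hJl _ _ hh0⟩ (fun b x ↦ s b x) b
  exact ⟨fun b ↦ (h b).1, hh0, fun b ↦ hs b (h b)⟩

section DoubleComplex

variable {R : Type} [CommRing R]

lemma exists_comp_eq_of_exact_of_injective {A B C E : Type} [AddCommGroup A] [Module R A]
    [AddCommGroup B] [Module R B] [AddCommGroup C] [Module R C] [AddCommGroup E] [Module R E]
    [Module.Injective R E] {p : A →ₗ[R] B} {q : B →ₗ[R] C} (h : Function.Exact p q)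
    (y : B →ₗ[R] E) (hy : y ∘ₗ p = 0) : ∃ z : C →ₗ[R] E, z ∘ₗ q = y := by
  have hk : LinearMap.ker q ≤ LinearMap.ker y := by
    rw [h.linearMap_ker_eq, LinearMap.range_le_ker_iff, hy]
  obtain ⟨z, hz⟩ := Module.Injective.out (R := R) (Q := E)
    ((LinearMap.ker q).liftQ q le_rfl) (LinearMap.ker_eq_bot.1 (Submodule.ker_liftQ_eq_bot' _ _ rfl))
    ((LinearMap.ker q).liftQ y hk)
  exact ⟨z, LinearMap.ext fun b ↦ hz (Submodule.Quotient.mk b)⟩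

lemma exists_comp_eq_of_exact_of_projective {A B C E : Type} [AddCommGroup A] [Module R A]
    [AddCommGroup B] [Module R B] [AddCommGroup C] [Module R C] [AddCommGroup E] [Module R E]
    [Module.Projective R E] {p : A →ₗ[R] B} {q : B →ₗ[R] C} (h : Function.Exact p q)
    (y : E →ₗ[R] B) (hy : q ∘ₗ y = 0) : ∃ z : E →ₗ[R] A, p ∘ₗ z = y := by
  obtain ⟨z, hz⟩ := Module.projective_lifting_property p.rangeRestrict
    (y.codRestrict (LinearMap.range p) fun e ↦ (h _).1 (LinearMap.congr_fun hy e))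
    p.surjective_rangeRestrict
  exact ⟨z, LinearMap.ext fun e ↦ congrArg Subtype.val (LinearMap.congr_fun hz e)⟩

variable {F I : ℕ → Type} [∀ a, AddCommGroup (F a)] [∀ a, Module R (F a)]
  [∀ b, AddCommGroup (I b)] [∀ b, Module R (I b)]
  (dF : ∀ a, F (a + 1) →ₗ[R] F a) (dI : ∀ b, I b →ₗ[R] I (b + 1))

/-- Precomposition with the differential of `F`, up to the sign of the row `b`. -/
def rowDifferential (b : ℕ) : (∀ a, F a →ₗ[R] I b) →ₗ[R] (∀ a, F a →ₗ[R] I b) where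
  toFun y
    | 0 => 0
    | a + 1 => (-1 : R) ^ b • (y a ∘ₗ dF a)
  map_add' y z := by
    funext a
    cases a <;> simp [LinearMap.add_comp]
  map_smul' r y := by
    funext a
    cases a <;> simp [LinearMap.smul_comp, smul_comm r]

/-- Postcomposition with the differential of `I`. -/
def columnDifferential (a : ℕ) : (∀ b, F a →ₗ[R] I b) →ₗ[R] (∀ b, F a →ₗ[R] I b) where
  toFun y
    | 0 => 0
    | b + 1 => dI b ∘ₗ y b
  map_add' y z := by
    funext b
    cases b <;> simp [LinearMap.comp_add]
  map_smul' r y := by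
    funext b
    cases b <;> simp [LinearMap.comp_smul]

/-- The total differential of the double complex `Hom (F, I)`, on the product of all its terms. -/
def totalDifferential : (∀ a b, F a →ₗ[R] I b) →ₗ[R] (∀ a b, F a →ₗ[R] I b) where
  toFun f a b := columnDifferential dI a (f a) b + rowDifferential dF b (fun a ↦ f a b) a
  map_add' f g := by
    funext a b
    have := congrFun ((rowDifferential dF b).map_add (fun a ↦ f a b) (fun a ↦ g a b)) a
    simp only [Pi.add_apply, map_add]
    rw [add_add_add_comm]
    exact congrArg (_ + ·) this
  map_smul' r f := by
    funext a b
    have := congrFun ((rowDifferential dF b).map_smul r (fun a ↦ f a b)) a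
    simp only [Pi.smul_apply, map_smul, RingHom.id_apply, smul_add]
    exact congrArg (_ + ·) this

lemma totalDifferential_zero_zero (f : ∀ a b, F a →ₗ[R] I b) :
    totalDifferential dF dI f 0 0 = 0 :=
  add_zero _

lemma totalDifferential_zero_succ (f : ∀ a b, F a →ₗ[R] I b) (b : ℕ) :
    totalDifferential dF dI f 0 (b + 1) = dI b ∘ₗ f 0 b :=
  add_zero _

lemma totalDifferential_succ_zero (f : ∀ a b, F a →ₗ[R] I b) (a : ℕ) :
    totalDifferential dF dI f (a + 1) 0 = f a 0 ∘ₗ dF a :=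
  (zero_add _).trans (by simp [rowDifferential])

lemma totalDifferential_succ_succ (f : ∀ a b, F a →ₗ[R] I b) (a b : ℕ) :
    totalDifferential dF dI f (a + 1) (b + 1) =
      dI b ∘ₗ f (a + 1) b + (-1 : R) ^ (b + 1) • (f a (b + 1) ∘ₗ dF a) :=
  rfl

lemma totalDifferential_comp_self (hF : ∀ a, dF a ∘ₗ dF (a + 1) = 0)
    (hI : ∀ b, dI (b + 1) ∘ₗ dI b = 0) (f : ∀ a b, F a →ₗ[R] I b) :
    totalDifferential dF dI (totalDifferential dF dI f) = 0 := by
  have hF' : ∀ a x, dF a (dF (a + 1) x) = 0 := fun a x ↦ LinearMap.congr_fun (hF a) x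
  have hI' : ∀ b x, dI (b + 1) (dI b x) = 0 := fun b x ↦ LinearMap.congr_fun (hI b) x
  funext a b
  rcases a with _ | _ | a <;> rcases b with _ | _ | b <;> ext x <;>
    simp [totalDifferential_zero_zero, totalDifferential_zero_succ, totalDifferential_succ_zero,
      totalDifferential_succ_succ, hF', hI', pow_succ]

/-- The kernel of the row differentials in each column, supported in column zero. -/
def rowKernel : Submodule R (∀ a b, F a →ₗ[R] I b) where
  carrier := {f | ∀ b, (∀ a, f (a + 1) b = 0) ∧ f 0 b ∘ₗ dF 0 = 0}
  add_mem' hf hg b := ⟨fun a ↦ by simp [(hf b).1, (hg b).1],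
    by simp [LinearMap.add_comp, (hf b).2, (hg b).2]⟩
  zero_mem' _ := ⟨fun _ ↦ rfl, LinearMap.zero_comp _⟩
  smul_mem' r f hf b := ⟨fun a ↦ by simp [(hf b).1], by simp [LinearMap.smul_comp, (hf b).2]⟩

lemma totalDifferential_mem_rowKernel (f : ∀ a b, F a →ₗ[R] I b) (hf : f ∈ rowKernel dF) :
    totalDifferential dF dI f ∈ rowKernel dF := by
  intro b
  have h : ∀ a, f a b ∘ₗ dF a = 0 := fun a ↦ by
    cases a
    · exact (hf b).2
    · rw [(hf b).1, LinearMap.zero_comp]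
  refine ⟨fun a ↦ ?_, ?_⟩
  · cases b
    · rw [totalDifferential_succ_zero, h]
    · rw [totalDifferential_succ_succ, h, (hf _).1, LinearMap.comp_zero, smul_zero, add_zero]
  · cases b
    · rw [totalDifferential_zero_zero, LinearMap.zero_comp]
    · rw [totalDifferential_zero_succ, LinearMap.comp_assoc, (hf _).2, LinearMap.comp_zero]

lemma smul_eq_zero_of_mem_rowKernel {𝔪 : Ideal R} (h𝔪 : ∀ r ∈ 𝔪, ∀ x, r • x ∈ LinearMap.range (dF 0))
    (r : R) (hr : r ∈ 𝔪) (f : ∀ a b, F a →ₗ[R] I b) (hf : f ∈ rowKernel dF) : r • f = 0 := by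
  funext a b
  cases a with
  | zero =>
    ext x
    obtain ⟨y, hy⟩ := h𝔪 r hr x
    have := LinearMap.congr_fun (hf b).2 y
    simpa [hy] using this
  | succ a => simp [(hf b).1]

lemma exists_sub_totalDifferential_mem_rowKernel [∀ b, Module.Injective R (I b)]
    (hF : ∀ a, Function.Exact (dF (a + 1)) (dF a)) (hI : ∀ b, dI (b + 1) ∘ₗ dI b = 0)
    (f : ∀ a b, F a →ₗ[R] I b) (hf : totalDifferential dF dI f ∈ rowKernel dF) :
    ∃ h, f - totalDifferential dF dI h ∈ rowKernel dF := by
  obtain ⟨h, h₀, h₁⟩ := exists_sub_mem_of_rows (Y := fun b ↦ ∀ a, F a →ₗ[R] I b)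
    (fun b ↦ (rowDifferential dF b).toAddMonoidHom)
    (fun b ↦ AddMonoidHom.mk' (fun y a ↦ dI b ∘ₗ y a)
      fun y z ↦ by funext a; simp [LinearMap.comp_add])
    (fun b ↦ { carrier := {y | (∀ a, y (a + 1) = 0) ∧ y 0 ∘ₗ dF 0 = 0}
               add_mem' := fun hy hz ↦ ⟨fun a ↦ by simp [hy.1, hz.1],
                by simp [LinearMap.add_comp, hy.2, hz.2]⟩
               zero_mem' := ⟨fun _ ↦ rfl, LinearMap.zero_comp _⟩
               neg_mem' := fun hy ↦ ⟨fun a ↦ by simp [hy.1], by simp [LinearMap.neg_comp, hy.2]⟩ })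
    (fun b y ↦ by
      funext a
      change dI (b + 1) ∘ₗ dI b ∘ₗ y a = 0
      rw [← LinearMap.comp_assoc, hI, LinearMap.zero_comp])
    (fun b y ↦ by
      funext a
      cases a <;> ext x <;> simp [rowDifferential, pow_succ])
    (fun b y hy ↦ by
      have hy' : ∀ a, y a ∘ₗ dF a = 0 := fun a ↦ by
        have : (-1 : R) ^ b • (y a ∘ₗ dF a) = 0 := hy.1 a
        simpa [smul_smul, ← mul_pow] using congrArg (fun z ↦ (-1 : R) ^ b • z) this
      choose z hz using fun a ↦ exists_comp_eq_of_exact_of_injective (hF a) (y (a + 1))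
        (hy' (a + 1))
      refine ⟨fun a ↦ (-1 : R) ^ b • z a, fun a ↦ ?_, ?_⟩
      · change y (a + 1) - (-1 : R) ^ b • (((-1 : R) ^ b • z a) ∘ₗ dF a) = 0
        rw [LinearMap.smul_comp, hz, smul_smul, ← mul_pow]
        simp
      · change (y 0 - 0) ∘ₗ dF 0 = 0
        rw [sub_zero, hy'])
    (fun b y hy ↦ ⟨fun a ↦ by
      change dI b ∘ₗ y (a + 1) = 0
      rw [hy.1, LinearMap.comp_zero], by
      change (dI b ∘ₗ y 0) ∘ₗ dF 0 = 0
      rw [LinearMap.comp_assoc, hy.2, LinearMap.comp_zero]⟩)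
    (fun b a ↦ f a b)
    (by
      have e : ∀ a, rowDifferential dF 0 (fun a ↦ f a 0) a = totalDifferential dF dI f a 0 :=
        fun a ↦ (zero_add _).symm
      exact ⟨fun a ↦ (e _).trans ((hf 0).1 a), (congrArg (· ∘ₗ dF 0) (e 0)).trans (hf 0).2⟩)
    (fun b ↦ hf (b + 1))
  refine ⟨fun a b ↦ h b a, fun b ↦ ?_⟩
  cases b with
  | zero =>
    have e : ∀ a, totalDifferential dF dI (fun a b ↦ h b a) a 0 = rowDifferential dF 0 (h 0) a :=
      fun a ↦ zero_add _
    exact ⟨fun a ↦ (congrArg (f (a + 1) 0 - ·) (e _)).trans (h₀.1 a),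
      (congrArg (fun z ↦ (f 0 0 - z) ∘ₗ dF 0) (e 0)).trans h₀.2⟩
  | succ b => exact h₁ b

/-- The total differential induces an acyclic differential modulo the row kernel. -/
lemma exact_mapQ_totalDifferential [∀ b, Module.Injective R (I b)]
    (hF : ∀ a, Function.Exact (dF (a + 1)) (dF a)) (hI : ∀ b, dI (b + 1) ∘ₗ dI b = 0) :
    Function.Exact
      ((rowKernel dF).mapQ (rowKernel dF) (totalDifferential dF dI)
        (totalDifferential_mem_rowKernel dF dI))
      ((rowKernel dF).mapQ (rowKernel dF) (totalDifferential dF dI)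
        (totalDifferential_mem_rowKernel dF dI)) := by
  intro x
  obtain ⟨f, rfl⟩ := Submodule.mkQ_surjective _ x
  refine ⟨fun hx ↦ ?_, ?_⟩
  · obtain ⟨h, hh⟩ := exists_sub_totalDifferential_mem_rowKernel dF dI hF hI f
      ((Submodule.Quotient.mk_eq_zero _).1 hx)
    exact ⟨Submodule.Quotient.mk h, ((Submodule.Quotient.eq _).2 hh).symm⟩
  · rintro ⟨y, hy⟩
    obtain ⟨g, rfl⟩ := Submodule.mkQ_surjective _ y
    rw [← hy]
    change Submodule.Quotient.mk (totalDifferential dF dI (totalDifferential dF dI g)) = 0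
    rw [totalDifferential_comp_self dF dI (fun a ↦ (hF a).linearMap_comp_eq_zero) hI]
    rfl

lemma exists_sub_totalDifferential_of_columns [∀ a, Module.Projective R (F a)]
    (hF : ∀ a, dF a ∘ₗ dF (a + 1) = 0) (hI : ∀ b, Function.Exact (dI b) (dI (b + 1)))
    (f : ∀ a b, F a →ₗ[R] I b) (hf : ∀ a, (∀ b, totalDifferential dF dI f a (b + 1) = 0) ∧
      dI 0 ∘ₗ totalDifferential dF dI f a 0 = 0) :
    ∃ h, ∀ a, (∀ b, (f - totalDifferential dF dI h) a (b + 1) = 0) ∧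
      dI 0 ∘ₗ (f - totalDifferential dF dI h) a 0 = 0 := by
  obtain ⟨h, h₀, h₁⟩ := exists_sub_mem_of_rows (Y := fun a ↦ ∀ b, F a →ₗ[R] I b)
    (fun a ↦ (columnDifferential dI a).toAddMonoidHom)
    (fun a ↦ AddMonoidHom.mk' (fun y b ↦ (-1 : R) ^ b • (y b ∘ₗ dF a))
      fun y z ↦ by funext a; simp [LinearMap.add_comp])
    (fun b ↦ { carrier := {y | (∀ b, y (b + 1) = 0) ∧ dI 0 ∘ₗ y 0 = 0}
               add_mem' := fun hy hz ↦ ⟨fun a ↦ by simp [hy.1, hz.1],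
                by simp [LinearMap.comp_add, hy.2, hz.2]⟩
               zero_mem' := ⟨fun _ ↦ rfl, LinearMap.comp_zero _⟩
               neg_mem' := fun hy ↦ ⟨fun a ↦ by simp [hy.1], by simp [LinearMap.comp_neg, hy.2]⟩ })
    (fun a y ↦ by
      funext b
      ext x
      have : dF a (dF (a + 1) x) = 0 := LinearMap.congr_fun (hF a) x
      simp [this])
    (fun a y ↦ by
      funext b
      cases b <;> ext x <;> simp [columnDifferential, pow_succ])
    (fun a y hy ↦ by
      have hy' : ∀ b, dI b ∘ₗ y b = 0 := hy.1
      choose z hz using fun b ↦ exists_comp_eq_of_exact_of_projective (hI b) (y (b + 1))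
        (hy' (b + 1))
      refine ⟨z, fun b ↦ ?_, ?_⟩
      · change y (b + 1) - dI b ∘ₗ z b = 0
        rw [hz, sub_self]
      · change dI 0 ∘ₗ (y 0 - 0) = 0
        rw [sub_zero, hy'])
    (fun a y hy ↦ ⟨fun b ↦ by
      change (-1 : R) ^ (b + 1) • (y (b + 1) ∘ₗ dF a) = 0
      rw [hy.1, LinearMap.zero_comp, smul_zero], by
      change dI 0 ∘ₗ ((-1 : R) ^ 0 • (y 0 ∘ₗ dF a)) = 0
      rw [pow_zero, one_smul, ← LinearMap.comp_assoc, hy.2, LinearMap.zero_comp]⟩)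
    f
    (by
      have e : ∀ b, columnDifferential dI 0 (f 0) b = totalDifferential dF dI f 0 b :=
        fun b ↦ (add_zero _).symm
      exact ⟨fun b ↦ (e _).trans ((hf 0).1 b), (congrArg (dI 0 ∘ₗ ·) (e 0)).trans (hf 0).2⟩)
    (fun a ↦ by
      have e : ∀ b, (-1 : R) ^ b • (f a b ∘ₗ dF a) + columnDifferential dI (a + 1) (f (a + 1)) b =
          totalDifferential dF dI f (a + 1) b := fun b ↦ add_comm _ _
      exact ⟨fun b ↦ (e _).trans ((hf (a + 1)).1 b),
        (congrArg (dI 0 ∘ₗ ·) (e 0)).trans (hf (a + 1)).2⟩)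
  refine ⟨h, fun a ↦ ?_⟩
  cases a with
  | zero =>
    have e : ∀ b, totalDifferential dF dI h 0 b = columnDifferential dI 0 (h 0) b :=
      fun b ↦ add_zero _
    exact ⟨fun b ↦ (congrArg (f 0 (b + 1) - ·) (e _)).trans (h₀.1 b),
      (congrArg (fun z ↦ dI 0 ∘ₗ (f 0 0 - z)) (e 0)).trans h₀.2⟩
  | succ a =>
    have e : ∀ b, totalDifferential dF dI h (a + 1) b =
        (-1 : R) ^ b • (h a b ∘ₗ dF a) + columnDifferential dI (a + 1) (h (a + 1)) b :=
      fun b ↦ add_comm _ _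
    exact ⟨fun b ↦ (congrArg (f (a + 1) (b + 1) - ·) (e _)).trans ((h₁ a).1 b),
      (congrArg (fun z ↦ dI 0 ∘ₗ (f (a + 1) 0 - z)) (e 0)).trans (h₁ a).2⟩

variable {E : Type} [AddCommGroup E] [Module R E] (ι : E →ₗ[R] I 0)

/-- The inclusion of `Hom (F q, E)` in the double complex `Hom (F, I)` given by an augmentation
`E → I 0`. -/
noncomputable def augmentation (q : ℕ) : (F q →ₗ[R] E) →ₗ[R] (∀ a b, F a →ₗ[R] I b) :=
  LinearMap.single R (fun a ↦ ∀ b, F a →ₗ[R] I b) q ∘ₗ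
    LinearMap.single R (fun b ↦ F q →ₗ[R] I b) 0 ∘ₗ LinearMap.llcomp R (F q) E (I 0) ι

lemma augmentation_same (q : ℕ) (c : F q →ₗ[R] E) : augmentation ι q c q 0 = ι ∘ₗ c := by
  simp [augmentation]
  rfl

lemma augmentation_succ (q : ℕ) (c : F q →ₗ[R] E) (a b : ℕ) :
    augmentation ι q c a (b + 1) = 0 := by
  obtain rfl | h := eq_or_ne a q
  · simp [augmentation]
  · simp [augmentation, h]

lemma augmentation_of_ne (q : ℕ) (c : F q →ₗ[R] E) (a b : ℕ) (h : a ≠ q) :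
    augmentation ι q c a b = 0 := by
  simp [augmentation, h]

lemma totalDifferential_augmentation (hι : dI 0 ∘ₗ ι = 0) (q : ℕ) (c : F q →ₗ[R] E) :
    totalDifferential dF dI (augmentation ι q c) = augmentation ι (q + 1) (c ∘ₗ dF q) := by
  have h : ∀ a b, dI b ∘ₗ augmentation ι q c a b = 0 := fun a b ↦ by
    obtain rfl | ha := eq_or_ne a q
    · cases b
      · rw [augmentation_same, ← LinearMap.comp_assoc, hι, LinearMap.zero_comp]
      · rw [augmentation_succ, LinearMap.comp_zero]
    · rw [augmentation_of_ne _ _ _ _ _ ha, LinearMap.comp_zero]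
  funext a b
  cases a with
  | zero =>
    rw [augmentation_of_ne _ _ _ _ _ (by omega)]
    cases b
    · rw [totalDifferential_zero_zero]
    · rw [totalDifferential_zero_succ, h]
  | succ a =>
    cases b with
    | zero =>
      rw [totalDifferential_succ_zero]
      obtain rfl | ha := eq_or_ne a q
      · rw [augmentation_same, augmentation_same, LinearMap.comp_assoc]
      · rw [augmentation_of_ne _ _ _ _ _ ha, augmentation_of_ne _ _ _ _ _ (by omega),
          LinearMap.zero_comp]
    | succ b =>
      rw [totalDifferential_succ_succ, h, augmentation_succ, augmentation_succ,
        LinearMap.zero_comp, smul_zero, add_zero]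

lemma exists_comp_eq_of_augmentation_eq [∀ a, Module.Projective R (F a)]
    (hF : ∀ a, dF a ∘ₗ dF (a + 1) = 0) (hI : ∀ b, Function.Exact (dI b) (dI (b + 1)))
    (hι : Function.Exact ι (dI 0)) (hι' : Function.Injective ι) (q : ℕ) (c : F (q + 1) →ₗ[R] E)
    (f : ∀ a b, F a →ₗ[R] I b) (hf : augmentation ι (q + 1) c = totalDifferential dF dI f) :
    ∃ c' : F q →ₗ[R] E, c' ∘ₗ dF q = c := by
  obtain ⟨h, hh⟩ := exists_sub_totalDifferential_of_columns dF dI hF hI f fun a ↦ by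
    rw [← hf]
    refine ⟨fun b ↦ augmentation_succ _ _ _ _ _, ?_⟩
    obtain rfl | ha := eq_or_ne a (q + 1)
    · rw [augmentation_same, ← LinearMap.comp_assoc, hι.linearMap_comp_eq_zero,
        LinearMap.zero_comp]
    · rw [augmentation_of_ne _ _ _ _ _ ha, LinearMap.comp_zero]
  obtain ⟨c', hc'⟩ := exists_comp_eq_of_exact_of_projective hι _ (hh q).2
  refine ⟨c', ?_⟩
  have e : totalDifferential dF dI (f - totalDifferential dF dI h) (q + 1) 0 = ι ∘ₗ c := by
    rw [map_sub, totalDifferential_comp_self dF dI hF fun b ↦ (hI b).linearMap_comp_eq_zero,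
      sub_zero, ← hf, augmentation_same]
  rw [totalDifferential_succ_zero, ← hc', LinearMap.comp_assoc] at e
  exact (LinearMap.cancel_left hι').1 e

end DoubleComplex

section Kunneth

variable {R : Type} [CommRing R]

lemma FlatDimLE.exists_presentation (n : ℕ) (M : Type) [AddCommGroup M] [Module R M]
    (hM : FlatDimLE R n M) : ∃ (k : ℕ) (M' Q : ModuleCat.{0} R) (u : M' →ₗ[R] Q) (v : Q →ₗ[R] M),
      Module.Flat R Q ∧ Function.Injective u ∧ Function.Exact u v ∧ Function.Surjective v ∧
        FlatDimLE R k M' := by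
  cases n with
  | zero =>
    have : Module.Flat R M := hM
    exact ⟨0, ModuleCat.of R PUnit, ModuleCat.of R M, 0, LinearMap.id, this,
      fun _ _ _ ↦ Subsingleton.elim _ _, fun x ↦ ⟨fun h ↦ ⟨0, h.symm⟩, by rintro ⟨_, rfl⟩; rfl⟩,
      Function.surjective_id, inferInstanceAs (Module.Flat R PUnit)⟩
  | succ n => exact ⟨n, hM⟩

lemma eq_zero_of_tmul_eq_zero {𝔪 : Ideal R} [𝔪.IsMaximal] {Q M : Type} [AddCommGroup Q]
    [Module R Q] [AddCommGroup M] [Module R M] (hQ : ∀ r ∈ 𝔪, ∀ t : Q, r • t = 0) (m : M)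
    (hm : m ∉ 𝔪 • (⊤ : Submodule R M)) (t : Q) (h : t ⊗ₜ[R] m = 0) : t = 0 := by
  let := Ideal.Quotient.field 𝔪
  obtain ⟨l, hl⟩ := Module.Projective.exists_dual_eq_one (R ⧸ 𝔪)
    (x := (Submodule.Quotient.mk m : M ⧸ 𝔪 • (⊤ : Submodule R M)))
    (fun h ↦ hm ((Submodule.Quotient.mk_eq_zero _).1 h))
  let s : (R ⧸ 𝔪) →ₗ[R] Q →ₗ[R] Q := Submodule.liftQ 𝔪 (LinearMap.lsmul R Q) fun r hr ↦
    LinearMap.ext fun t ↦ hQ r hr t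
  let B : Q →ₗ[R] M →ₗ[R] Q := LinearMap.flip (s ∘ₗ l.restrictScalars R ∘ₗ Submodule.mkQ _)
  have h' := congrArg (TensorProduct.lift B) h
  have e : s (1 : R ⧸ 𝔪) = LinearMap.id := LinearMap.ext fun t ↦ one_smul R t
  simpa [B, hl, e] using h'

lemma FlatDimLE.exists_eq_of_tmul_eq {𝔪 : Ideal R} [𝔪.IsMaximal] {C : ℕ → Type}
    [∀ q, AddCommGroup (C q)] [∀ q, Module R (C q)] [∀ q, Module.Flat R (C q)]
    (d : ∀ q, C q →ₗ[R] C (q + 1)) (hd : ∀ q, d (q + 1) ∘ₗ d q = 0) {X : Type} [AddCommGroup X]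
    [Module R X] (D : X →ₗ[R] X) (hD : ∀ x, D (D x) = 0) (J : Submodule R X)
    (hDJ : J ≤ J.comap D) (hJ : Function.Exact (J.mapQ J D hDJ) (J.mapQ J D hDJ))
    (h𝔪 : ∀ r ∈ 𝔪, ∀ x ∈ J, r • x = 0) (g : ∀ q, C q →ₗ[R] X)
    (hg : ∀ q, D ∘ₗ g q = g (q + 1) ∘ₗ d q) (n : ℕ) (M : Type) [AddCommGroup M] [Module R M]
    (hM : FlatDimLE R n M) (m : M) (hm : m ∉ 𝔪 • (⊤ : Submodule R M)) (q : ℕ) (c : C (q + 1))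
    (hc : d (q + 1) c = 0) (b : TensorProduct R (C q) M) (hb : (d q).rTensor M b = c ⊗ₜ m) :
    ∃ x, g (q + 1) c = D x := by
  obtain ⟨k, M₁, P, u, v, _, hu, huv, hv, hM₁⟩ := hM.exists_presentation
  have hdd : ∀ q (N : Type) [AddCommGroup N] [Module R N] (x),
      (d (q + 1)).rTensor N ((d q).rTensor N x) = 0 := fun q N _ _ x ↦ by
    rw [← LinearMap.comp_apply, ← LinearMap.rTensor_comp, hd, LinearMap.rTensor_zero,
      LinearMap.zero_apply]
  have hDD : ∀ (N : Type) [AddCommGroup N] [Module R N] (x),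
      D.rTensor N (D.rTensor N x) = 0 := fun N _ _ x ↦ by
    have : D ∘ₗ D = 0 := LinearMap.ext hD
    rw [← LinearMap.comp_apply, ← LinearMap.rTensor_comp, this, LinearMap.rTensor_zero,
      LinearMap.zero_apply]
  have hg' : ∀ q (N : Type) [AddCommGroup N] [Module R N] (x),
      D.rTensor N ((g q).rTensor N x) = (g (q + 1)).rTensor N ((d q).rTensor N x) :=
    fun q N _ _ x ↦ by
      rw [← LinearMap.comp_apply, ← LinearMap.rTensor_comp, hg, LinearMap.rTensor_comp,
        LinearMap.comp_apply]
  have hπ : ∀ (N : Type) [AddCommGroup N] [Module R N] (x),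
      (J.mapQ J D hDJ).rTensor N (J.mkQ.rTensor N x) = J.mkQ.rTensor N (D.rTensor N x) :=
    fun N _ _ x ↦ by
      rw [← LinearMap.comp_apply, ← LinearMap.rTensor_comp, Submodule.mapQ_mkQ,
        LinearMap.rTensor_comp, LinearMap.comp_apply]
  have hJN : ∀ (N : Type) [AddCommGroup N] [Module R N],
      Function.Exact (J.subtype.rTensor N) (J.mkQ.rTensor N) := fun N _ _ ↦
    rTensor_exact N (LinearMap.exact_subtype_mkQ J) J.mkQ_surjective
  have hDJ' : ∀ (N : Type) [AddCommGroup N] [Module R N] (x),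
      D.rTensor N (J.subtype.rTensor N x) = J.subtype.rTensor N ((D.restrict hDJ).rTensor N x) :=
    fun N _ _ x ↦ by
      rw [← LinearMap.comp_apply, ← LinearMap.comp_apply, ← LinearMap.rTensor_comp,
        ← LinearMap.rTensor_comp]
      rfl
  obtain ⟨s, rfl⟩ := hv m
  obtain ⟨b, rfl⟩ := LinearMap.lTensor_surjective _ hv b
  obtain ⟨c₁, hc₁⟩ : ∃ c₁, u.lTensor (C (q + 1)) c₁ = (d q).rTensor P b - c ⊗ₜ s := by
    refine (lTensor_exact _ huv hv _).1 ?_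
    rw [map_sub, ← rTensor_lTensor_comm, hb, LinearMap.lTensor_tmul, sub_self]
  have hc₁0 : (d (q + 1)).rTensor M₁ c₁ = 0 := by
    apply Module.Flat.lTensor_preserves_injective_linearMap (M := C (q + 2)) u hu
    rw [← rTensor_lTensor_comm, hc₁, map_sub, hdd, LinearMap.rTensor_tmul, hc,
      TensorProduct.zero_tmul, sub_self, map_zero]
  obtain ⟨y₁, hy₁⟩ := FlatDimLE.exists_rTensor_eq d hd (J.mapQ J D hDJ) hJ (fun q ↦ J.mkQ ∘ₗ g q)
    (fun q ↦ by
      rw [← LinearMap.comp_assoc, Submodule.mapQ_mkQ, LinearMap.comp_assoc, hg,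
        LinearMap.comp_assoc]) k M₁ hM₁ (q + 1) c₁ hc₁0
  obtain ⟨y₁, rfl⟩ := LinearMap.rTensor_surjective _ J.mkQ_surjective y₁
  obtain ⟨j₁, hj₁⟩ := (hJN M₁ ((g (q + 1)).rTensor M₁ c₁ - D.rTensor M₁ y₁)).1 (by
    rw [map_sub, ← hπ, hy₁, LinearMap.rTensor_comp, LinearMap.comp_apply, sub_self])
  obtain ⟨y₀, hy₀⟩ := (hJ (J.mkQ (g (q + 1) c))).1 (by
    rw [← LinearMap.comp_apply, Submodule.mapQ_mkQ, LinearMap.comp_apply]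
    have : D (g (q + 1) c) = 0 := by
      rw [← LinearMap.comp_apply, hg, LinearMap.comp_apply, hc, map_zero]
    rw [this, map_zero])
  obtain ⟨y₀, rfl⟩ := J.mkQ_surjective y₀
  have hj₀ : g (q + 1) c - D y₀ ∈ J := (Submodule.Quotient.eq J).1 hy₀.symm
  set j₀ : J := ⟨_, hj₀⟩ with hj₀_def
  obtain ⟨w, hw⟩ : ∃ w, w = (g q).rTensor P b - u.lTensor X y₁ - y₀ ⊗ₜ s := ⟨_, rfl⟩
  have hDw : D.rTensor P w = J.subtype.rTensor P (j₀ ⊗ₜ s + u.lTensor J j₁) := by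
    rw [hw, map_sub, map_sub, map_add, rTensor_lTensor_comm J.subtype, hj₁, map_sub,
      rTensor_lTensor_comm D, ← rTensor_lTensor_comm (g (q + 1)), hc₁, map_sub, hg',
      LinearMap.rTensor_tmul, LinearMap.rTensor_tmul, LinearMap.rTensor_tmul,
      Submodule.subtype_apply, hj₀_def, TensorProduct.sub_tmul]
    abel
  obtain ⟨z, hz⟩ := (Module.Flat.rTensor_exact P hJ (J.mkQ.rTensor P w)).1 (by
    rw [hπ, hDw]
    exact (hJN P _).2 ⟨_, rfl⟩)
  obtain ⟨z, rfl⟩ := LinearMap.rTensor_surjective _ J.mkQ_surjective z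
  obtain ⟨j₂, hj₂⟩ := (hJN P (w - D.rTensor P z)).1 (by rw [map_sub, ← hπ, hz, sub_self])
  have h : j₀ ⊗ₜ s + u.lTensor J j₁ = (D.restrict hDJ).rTensor P j₂ := by
    apply Module.Flat.rTensor_preserves_injective_linearMap (M := P) J.subtype J.subtype_injective
    rw [← hDw, ← hDJ', hj₂, map_sub, hDD, sub_zero]
  have h' := congrArg ((LinearMap.range (D.restrict hDJ)).mkQ.rTensor M) (congrArg (v.lTensor J) h)
  rw [map_add, (lTensor_exact J huv hv _).2 ⟨_, rfl⟩, add_zero, LinearMap.lTensor_tmul,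
    LinearMap.rTensor_tmul, ← rTensor_lTensor_comm, ← LinearMap.comp_apply,
    ← LinearMap.rTensor_comp, LinearMap.range_mkQ_comp, LinearMap.rTensor_zero,
    LinearMap.zero_apply] at h'
  have h₀ := eq_zero_of_tmul_eq_zero (𝔪 := 𝔪) (fun r hr t ↦ by
    obtain ⟨t, rfl⟩ := Submodule.mkQ_surjective _ t
    have ht : r • t = 0 := Subtype.ext (h𝔪 r hr t t.2)
    rw [← map_smul, ht, map_zero]) _ hm _ h'
  obtain ⟨e, he⟩ := (Submodule.Quotient.mk_eq_zero _).1 h₀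
  refine ⟨y₀ + e, ?_⟩
  have he' : D e = g (q + 1) c - D y₀ := congrArg Subtype.val he
  rw [map_add, he', add_sub_cancel]

/-- Let `F` be a projective resolution of `k = R / 𝔪`, with finite terms, so that
`Hom (F, R)` is a complex of flat modules. If a cocycle of `Hom (F, R)` becomes a coboundary in
`Hom (F, R) ⊗ M` after tensoring with a minimal generator of a module `M` of finite flat dimension,
then it is a coboundary. -/
lemma FlatDimLE.exists_comp_eq_of_tmul_eq {𝔪 : Ideal R} [𝔪.IsMaximal]
    {F I : ℕ → Type} [∀ a, AddCommGroup (F a)] [∀ a, Module R (F a)]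
    [∀ b, AddCommGroup (I b)] [∀ b, Module R (I b)] [∀ a, Module.Projective R (F a)]
    [∀ a, Module.Flat R (F a →ₗ[R] R)] [∀ b, Module.Injective R (I b)]
    (dF : ∀ a, F (a + 1) →ₗ[R] F a) (hF : ∀ a, Function.Exact (dF (a + 1)) (dF a))
    (h𝔪 : ∀ r ∈ 𝔪, ∀ x, r • x ∈ LinearMap.range (dF 0))
    (dI : ∀ b, I b →ₗ[R] I (b + 1)) (hI : ∀ b, Function.Exact (dI b) (dI (b + 1)))
    (ι : R →ₗ[R] I 0) (hι : Function.Exact ι (dI 0)) (hι' : Function.Injective ι)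
    (n : ℕ) (M : Type) [AddCommGroup M] [Module R M]
    (hM : FlatDimLE R n M) (m : M) (hm : m ∉ 𝔪 • (⊤ : Submodule R M)) (q : ℕ)
    (c : F (q + 1) →ₗ[R] R) (hc : c ∘ₗ dF (q + 1) = 0) (b : TensorProduct R (F q →ₗ[R] R) M)
    (hb : (LinearMap.lcomp R R (dF q)).rTensor M b = c ⊗ₜ m) :
    ∃ c' : F q →ₗ[R] R, c' ∘ₗ dF q = c := by
  have hF' := fun a ↦ (hF a).linearMap_comp_eq_zero
  have hI' := fun b ↦ (hI b).linearMap_comp_eq_zero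
  obtain ⟨f, hf⟩ := FlatDimLE.exists_eq_of_tmul_eq (𝔪 := 𝔪)
    (fun q ↦ LinearMap.lcomp R R (dF q))
    (fun q ↦ LinearMap.ext fun y ↦ by
      change (y ∘ₗ dF q) ∘ₗ dF (q + 1) = 0
      rw [LinearMap.comp_assoc, hF', LinearMap.comp_zero])
    (totalDifferential dF dI) (totalDifferential_comp_self dF dI hF' hI') (rowKernel dF)
    (totalDifferential_mem_rowKernel dF dI) (exact_mapQ_totalDifferential dF dI hF hI')
    (smul_eq_zero_of_mem_rowKernel dF h𝔪) (augmentation ι)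
    (fun q ↦ LinearMap.ext fun y ↦
      totalDifferential_augmentation dF dI ι hι.linearMap_comp_eq_zero q y)
    n M hM m hm q c hc b hb
  exact exists_comp_eq_of_augmentation_eq dF dI ι hF' hI hι hι' q c f hf

end Kunneth

section Resolutions

variable (R : Type) [CommRing R]

lemma exists_finite_free_resolution [IsNoetherianRing R] (M : Type) [AddCommGroup M] [Module R M]
    [Module.Finite R M] :
    ∃ (r : ℕ → ℕ) (d : ∀ a, (Fin (r (a + 1)) → R) →ₗ[R] (Fin (r a) → R))
      (ε : (Fin (r 0) → R) →ₗ[R] M), Function.Surjective ε ∧ Function.Exact (d 0) ε ∧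
        ∀ a, Function.Exact (d (a + 1)) (d a) := by
  obtain ⟨n, ε, hε⟩ := Module.Finite.exists_fin' R M
  have step : ∀ s : (n : ℕ) × Submodule R (Fin n → R), ∃ (n' : ℕ)
      (f : (Fin n' → R) →ₗ[R] (Fin s.1 → R)), LinearMap.range f = s.2 := fun s ↦ by
    obtain ⟨n', f, hf⟩ := Module.Finite.exists_fin' R s.2
    refine ⟨n', s.2.subtype ∘ₗ f, ?_⟩
    rw [LinearMap.range_comp, LinearMap.range_eq_top.2 hf, Submodule.map_top,
      Submodule.range_subtype]
  choose n' f hf using step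
  let s : ℕ → (n : ℕ) × Submodule R (Fin n → R) := fun a ↦
    Nat.rec ⟨n, LinearMap.ker ε⟩ (fun _ s ↦ ⟨n' s, LinearMap.ker (f s)⟩) a
  exact ⟨fun a ↦ (s a).1, fun a ↦ f (s a), ε, hε,
    LinearMap.exact_iff.2 (hf (s 0)).symm, fun a ↦ LinearMap.exact_iff.2 (hf (s (a + 1))).symm⟩

lemma exists_injective_resolution (M : Type) [AddCommGroup M] [Module R M] :
    ∃ (I : ℕ → ModuleCat.{0} R) (d : ∀ b, I b →ₗ[R] I (b + 1)) (ι : M →ₗ[R] I 0),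
      (∀ b, Module.Injective R (I b)) ∧ Function.Injective ι ∧ Function.Exact ι (d 0) ∧
        ∀ b, Function.Exact (d b) (d (b + 1)) := by
  have emb : ∀ (A : Type) [AddCommGroup A] [Module R A], ∃ (E : ModuleCat.{0} R) (j : A →ₗ[R] E),
      Module.Injective R E ∧ Function.Injective j := fun A _ _ ↦
    ⟨Injective.under (ModuleCat.of R A), (Injective.ι (ModuleCat.of R A)).hom,
      (Module.injective_iff_injective_object R _).2
        (Injective.injective_under (ModuleCat.of R A)),
      (ModuleCat.mono_iff_injective _).1 inferInstance⟩
  obtain ⟨E, ι, hE, hι⟩ := emb M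
  have step : ∀ s : (E : {E : ModuleCat.{0} R // Module.Injective R E}) × Submodule R E.1,
      ∃ (E' : {E : ModuleCat.{0} R // Module.Injective R E}) (f : s.1.1 →ₗ[R] E'.1),
        LinearMap.ker f = s.2 := fun s ↦ by
    obtain ⟨E', j, hE', hj⟩ := emb (s.1.1 ⧸ s.2)
    refine ⟨⟨E', hE'⟩, j ∘ₗ s.2.mkQ, ?_⟩
    rw [LinearMap.ker_comp_of_ker_eq_bot _ (LinearMap.ker_eq_bot.2 hj), Submodule.ker_mkQ]
  choose E' f hf using step
  let s : ℕ → (E : {E : ModuleCat.{0} R // Module.Injective R E}) × Submodule R E.1 := fun b ↦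
    Nat.rec ⟨⟨E, hE⟩, LinearMap.range ι⟩ (fun _ s ↦ ⟨E' s, LinearMap.range (f s)⟩) b
  exact ⟨fun b ↦ (s b).1.1, fun b ↦ f (s b), ι, fun b ↦ (s b).1.2, hι,
    LinearMap.exact_iff.2 (hf (s 0)), fun b ↦ LinearMap.exact_iff.2 (hf (s (b + 1)))⟩

end Resolutions

section Descent

variable {R : Type} [CommRing R]

/-- Exactness of `Hom (F, S)` in degree `q + 1` descends to exactness of `Hom (F, R)`, where `F` is
a resolution of the residue field. -/
lemma FlatDimLE.exists_comp_eq_of_algebraMap_comp_eq [IsLocalRing R] (S : Type) [CommRing S]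
    [IsLocalRing S] [Algebra R S] [IsLocalHom (algebraMap R S)] (n : ℕ) (hS : FlatDimLE R n S)
    (r : ℕ → ℕ) (d : ∀ a, (Fin (r (a + 1)) → R) →ₗ[R] (Fin (r a) → R))
    (ε : (Fin (r 0) → R) →ₗ[R] IsLocalRing.ResidueField R) (hε : Function.Exact (d 0) ε)
    (hd : ∀ a, Function.Exact (d (a + 1)) (d a)) (q : ℕ) (c : (Fin (r (q + 1)) → R) →ₗ[R] R)
    (hc : c ∘ₗ d (q + 1) = 0) (β : (Fin (r q) → R) →ₗ[R] S)
    (hβ : β ∘ₗ d q = Algebra.linearMap R S ∘ₗ c) :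
    ∃ c' : (Fin (r q) → R) →ₗ[R] R, c' ∘ₗ d q = c := by
  obtain ⟨I, dI, ι, hI, hι', hι, hdI⟩ := exists_injective_resolution R R
  have h1 : (1 : S) ∉ IsLocalRing.maximalIdeal R • (⊤ : Submodule R S) := fun h ↦ by
    have hle : IsLocalRing.maximalIdeal R • (⊤ : Submodule R S) ≤
        (IsLocalRing.maximalIdeal S).restrictScalars R := Submodule.smul_le.2 fun r hr s _ ↦ by
      rw [Submodule.restrictScalars_mem, Algebra.smul_def]
      exact Ideal.mul_mem_right _ _
        ((IsLocalRing.mem_maximalIdeal _).2 ((map_mem_nonunits_iff (algebraMap R S) r).2 hr))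
    exact (Ideal.ne_top_iff_one _).1 (IsLocalRing.maximalIdeal.isMaximal S).ne_top (hle h)
  obtain ⟨b, hb⟩ := (dualTensorHom_bijective (R := R) (M := Fin (r q) → R) (N := S)).2 β
  refine FlatDimLE.exists_comp_eq_of_tmul_eq (𝔪 := IsLocalRing.maximalIdeal R)
    (F := fun a ↦ Fin (r a) → R) (I := fun b ↦ I b)
    d hd (fun r hr x ↦ (hε _).1 ?_) dI hdI ι hι hι' n S hS 1 h1 q c hc b ?_
  · rw [map_smul]
    obtain ⟨y, hy⟩ := IsLocalRing.residue_surjective (ε x)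
    rw [← hy, Algebra.smul_def, IsLocalRing.ResidueField.algebraMap_eq, ← map_mul,
      IsLocalRing.residue_eq_zero_iff]
    exact Ideal.mul_mem_right _ _ hr
  · apply (dualTensorHom_bijective (R := R) (M := Fin (r (q + 1)) → R) (N := S)).1
    refine (LinearMap.congr_fun (dualTensorHom_comp_rTensor_dualMap (P := S) (d q)) b).trans ?_
    rw [LinearMap.comp_apply, hb]
    change β ∘ₗ d q = _
    rw [hβ]
    ext x
    simp [Algebra.smul_def]

end Descent

section ExtComparison

variable {R : Type} [CommRing R]

lemma subsingleton_extMod_succ_iff (M N : ModuleCat.{0} R) (i : ℕ) :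
    Subsingleton (extMod R M N (i + 1)) ↔ Subsingleton (Abelian.Ext.{0} M N (i + 1)) := by
  let P := projectiveResolution M
  trans ∀ f : P.complex.X (i + 1) ⟶ N, P.complex.d (i + 2) (i + 1) ≫ f = 0 →
    ∃ g : P.complex.X i ⟶ N, P.complex.d (i + 1) i ≫ g = f
  · rw [← ModuleCat.isZero_iff_subsingleton, extMod, (P.isoExt (i + 1) N).isZero_iff,
      ← HomologicalComplex.exactAt_iff_isZero_homology,
      HomologicalComplex.exactAt_iff' _ i (i + 1) (i + 2) (by simp) (by simp),
      ShortComplex.moduleCat_exact_iff]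
    rfl
  · refine ⟨fun h ↦ ⟨fun x y ↦ ?_⟩, fun h f hf ↦ ?_⟩
    · suffices ∀ x : Abelian.Ext.{0} M N (i + 1), x = 0 by rw [this x, this y]
      intro x
      obtain ⟨f, hf, rfl⟩ := P.extMk_surjective x (i + 2) rfl
      exact (P.extMk_eq_zero_iff f (i + 2) rfl hf i rfl).2 (h f hf)
    · exact (P.extMk_eq_zero_iff f (i + 2) rfl hf i rfl).1 (Subsingleton.elim _ _)

lemma isGorenstein_iff_exists_hasInjectiveDimensionLT :
    IsGorenstein R ↔ ∃ n, HasInjectiveDimensionLT (ModuleCat.of R R) n := by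
  constructor
  · rintro ⟨n, hn⟩
    exact ⟨n + 1, hasInjectiveDimensionLT_of_enoughProjectives.{0} _ _ fun M ↦
      (subsingleton_extMod_succ_iff _ _ _).1 (hn M (n + 1) n.lt_succ_self)⟩
  · rintro ⟨n, hn⟩
    refine ⟨n, fun M i hi ↦ ?_⟩
    obtain ⟨i, rfl⟩ := Nat.exists_eq_succ_of_ne_zero (Nat.ne_zero_of_lt hi)
    exact (subsingleton_extMod_succ_iff _ _ _).2
      (HasInjectiveDimensionLT.subsingleton _ n _ hi.le _)

end ExtComparison

section InjDim

/-- `N` has an injective resolution of length at most `n`. -/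
def InjDimLE (R : Type) [CommRing R] : ℕ → ∀ (N : Type) [AddCommGroup N] [Module R N], Prop
  | 0, N, _, _ => Module.Injective R N
  | n + 1, N, _, _ => ∃ (E N' : ModuleCat.{0} R) (u : N →ₗ[R] E) (v : E →ₗ[R] N'),
      Module.Injective R E ∧ Function.Injective u ∧ Function.Exact u v ∧ Function.Surjective v ∧
        InjDimLE R n N'

variable {R : Type} [CommRing R]

lemma injDimLE_of_hasInjectiveDimensionLT (n : ℕ) (N : ModuleCat.{0} R)
    [h : HasInjectiveDimensionLT N (n + 1)] : InjDimLE R n N := by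
  induction n generalizing N with
  | zero =>
    change Module.Injective R N
    exact (Module.injective_iff_injective_object R N).2
      (injective_iff_hasInjectiveDimensionLT_one.2 h)
  | succ n ih =>
    let S := ShortComplex.mk _ _ (Limits.cokernel.condition (Injective.ι N))
    have hS : S.ShortExact := { exact := ShortComplex.exact_cokernel _ }
    have := (hS.hasInjectiveDimensionLT_X₃_iff n
      (inferInstanceAs (Injective (Injective.under N)))).2 h
    exact ⟨S.X₂, S.X₃, S.f.hom, S.g.hom, (Module.injective_iff_injective_object R _).2
        (Injective.injective_under N), hS.moduleCat_injective_f,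
        (ShortComplex.ShortExact.moduleCat_exact_iff_function_exact S).1 hS.exact,
        hS.moduleCat_surjective_g, ih S.X₃⟩

/-- If a complex of projective modules is exact in high degrees, then so is its dual with values in
a module of finite injective dimension. -/
lemma InjDimLE.exists_comp_eq {G : ℕ → Type} [∀ q, AddCommGroup (G q)] [∀ q, Module R (G q)]
    [∀ q, Module.Projective R (G q)] (d : ∀ q, G (q + 1) →ₗ[R] G q) (p : ℕ)
    (hd : ∀ q ≥ p, Function.Exact (d (q + 1)) (d q)) (n : ℕ) (N : Type) [AddCommGroup N]
    [Module R N] (hN : InjDimLE R n N) (q : ℕ) (hq : p + n ≤ q) (c : G (q + 1) →ₗ[R] N)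
    (hc : c ∘ₗ d (q + 1) = 0) : ∃ c' : G q →ₗ[R] N, c' ∘ₗ d q = c := by
  induction n generalizing N q with
  | zero =>
    have : Module.Injective R N := hN
    exact exists_comp_eq_of_exact_of_injective (hd q hq) c hc
  | succ n ih =>
    obtain ⟨E, N', u, v, _, hu, huv, hv, hN'⟩ := hN
    obtain ⟨q, rfl⟩ : ∃ k, q = k + 1 := ⟨q - 1, by omega⟩
    obtain ⟨e, he⟩ := exists_comp_eq_of_exact_of_injective (hd (q + 1) (by omega)) (u ∘ₗ c)
      (by rw [LinearMap.comp_assoc, hc, LinearMap.comp_zero])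
    obtain ⟨f, hf⟩ := ih N' hN' q (by omega) (v ∘ₗ e) (by
      rw [LinearMap.comp_assoc, he, ← LinearMap.comp_assoc, huv.linearMap_comp_eq_zero,
        LinearMap.zero_comp])
    obtain ⟨f, rfl⟩ := Module.projective_lifting_property v f hv
    obtain ⟨c', hc'⟩ := exists_comp_eq_of_exact_of_projective huv (e - f ∘ₗ d q) (by
      rw [LinearMap.comp_sub, ← hf, LinearMap.comp_assoc, sub_self])
    refine ⟨c', (LinearMap.cancel_left hu).1 ?_⟩
    rw [← LinearMap.comp_assoc, hc', LinearMap.sub_comp, he, LinearMap.comp_assoc,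
      (hd q (by omega)).linearMap_comp_eq_zero, LinearMap.comp_zero, sub_zero]

end InjDim

section FlatDimension

variable {R : Type} [CommRing R]

lemma flat_of_lTensor_exact {P₂ P₁ P₀ L : Type} [AddCommGroup P₂] [Module R P₂]
    [AddCommGroup P₁] [Module R P₁] [AddCommGroup P₀] [Module R P₀] [AddCommGroup L] [Module R L]
    [Module.Flat R P₀] (d₂ : P₂ →ₗ[R] P₁) (d₁ : P₁ →ₗ[R] P₀) (v : P₀ →ₗ[R] L)
    (hv : Function.Surjective v) (h₀ : Function.Exact d₁ v)
    (h : ∀ M : ModuleCat.{0} R, Function.Exact (d₂.lTensor M) (d₁.lTensor M)) :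
    Module.Flat R L := by
  refine Module.Flat.iff_rTensor_injective'.2 fun I ↦ ?_
  rw [injective_iff_map_eq_zero]
  intro x hx
  obtain ⟨x, rfl⟩ := LinearMap.lTensor_surjective _ hv x
  rw [rTensor_lTensor_comm] at hx
  obtain ⟨y, hy⟩ := (lTensor_exact R h₀ hv _).1 hx
  have hI : ∀ (Q : Type) [AddCommGroup Q] [Module R Q],
      Function.Exact (I.subtype.rTensor Q) (I.mkQ.rTensor Q) := fun Q _ _ ↦
    rTensor_exact Q (LinearMap.exact_subtype_mkQ I) I.mkQ_surjective
  obtain ⟨z, hz⟩ := (h (ModuleCat.of R (R ⧸ I)) (I.mkQ.rTensor _ y)).1 (by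
    rw [← rTensor_lTensor_comm, hy]
    exact (hI P₀ _).2 ⟨x, rfl⟩)
  obtain ⟨z, rfl⟩ := LinearMap.rTensor_surjective _ I.mkQ_surjective z
  obtain ⟨y', hy'⟩ := (hI P₁ (y - d₂.lTensor R z)).1 (by
    rw [map_sub, rTensor_lTensor_comm, sub_eq_zero]
    exact hz.symm)
  have : d₁.lTensor I y' = x := by
    apply Module.Flat.rTensor_preserves_injective_linearMap (M := P₀) I.subtype I.subtype_injective
    rw [rTensor_lTensor_comm, hy', map_sub, hy,
      (h (ModuleCat.of R R) (d₂.lTensor R z)).2 ⟨z, rfl⟩, sub_zero]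
  rw [← this]
  exact (lTensor_exact I h₀ hv _).2 ⟨y', rfl⟩

lemma FlatDimLE.of_resolution (n : ℕ) (N : Type) [AddCommGroup N] [Module R N]
    (P : ℕ → ModuleCat.{0} R) [∀ a, Module.Flat R (P a)] (d : ∀ a, P (a + 1) →ₗ[R] P a)
    (v : P 0 →ₗ[R] N) (hv : Function.Surjective v) (hdv : Function.Exact (d 0) v)
    (hd : ∀ a, Function.Exact (d (a + 1)) (d a))
    (h : Module.Flat R (P n ⧸ LinearMap.range (d n))) : FlatDimLE R n N := by
  induction n generalizing N P with
  | zero =>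
    exact Module.Flat.of_linearEquiv (hdv.linearEquivOfSurjective hv).symm
  | succ n ih =>
    let v' : P 1 →ₗ[R] LinearMap.ker v :=
      (d 0).codRestrict _ fun x ↦ hdv.apply_apply_eq_zero x
    refine ⟨ModuleCat.of R (LinearMap.ker v), P 0, (LinearMap.ker v).subtype, v, inferInstance,
      Subtype.val_injective, v.exact_subtype_ker_map, hv, ?_⟩
    refine ih (LinearMap.ker v) (fun a ↦ P (a + 1)) (fun a ↦ d (a + 1)) v' ?_ ?_
      (fun a ↦ hd (a + 1)) h
    · rintro ⟨x, hx⟩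
      obtain ⟨y, rfl⟩ := (hdv x).1 hx
      exact ⟨y, rfl⟩
    · intro x
      rw [← hd 0 x]
      exact Subtype.ext_iff

lemma HasFiniteFlatDimension.exists_flatDimLE {N : ModuleCat.{0} R}
    (h : HasFiniteFlatDimension R N) : ∃ n, FlatDimLE R n N := by
  obtain ⟨n, hn⟩ := h
  let P := projectiveResolution N
  have hP : ∀ a, Module.Projective R (P.complex.X a) := fun a ↦
    (IsProjective.iff_projective _).2 (P.projective a)
  have hd : ∀ a, Function.Exact (P.complex.d (a + 2) (a + 1)).hom (P.complex.d (a + 1) a).hom :=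
    fun a ↦ (ShortComplex.ShortExact.moduleCat_exact_iff_function_exact _).1 (P.exact_succ a)
  refine ⟨n, FlatDimLE.of_resolution n N P.complex.X (fun a ↦ (P.complex.d (a + 1) a).hom)
    (P.π.f 0).hom ((ModuleCat.epi_iff_surjective _).1 inferInstance)
    ((ShortComplex.ShortExact.moduleCat_exact_iff_function_exact _).1 P.exact₀) hd ?_⟩
  refine flat_of_lTensor_exact (P.complex.d (n + 2) (n + 1)).hom
    (P.complex.d (n + 1) n).hom (Submodule.mkQ _) (Submodule.mkQ_surjective _)
    (LinearMap.exact_map_mkQ_range _) fun M ↦ ?_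
  have := hn M (n + 1) n.lt_succ_self
  rw [← ModuleCat.isZero_iff_subsingleton, torMod] at this
  have := (P.isoLeftDerivedObj ((MonoidalCategory.tensoringLeft (ModuleCat.{0} R)).obj M)
    (n + 1)).isZero_iff.1 this
  have := (HomologicalComplex.exactAt_iff' _ (n + 2) (n + 1) n (by simp) (by simp)).1
    ((HomologicalComplex.exactAt_iff_isZero_homology _ _).2 this)
  exact (ShortComplex.ShortExact.moduleCat_exact_iff_function_exact _).1 this

end FlatDimension

section BaseChange

open TensorProduct

variable {R S : Type} [CommRing R] [CommRing S] [Algebra R S]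

/-- If `S` is of finite flat dimension over `R` and of finite injective dimension over itself, then
`Hom(-, S)` preserves exactness of complexes of free `R`-modules in high degrees. -/
lemma FlatDimLE.exists_comp_eq_of_injDimLE (n m : ℕ) (hn : FlatDimLE R n S) (hm : InjDimLE S m S)
    {F : ℕ → Type} [∀ q, AddCommGroup (F q)] [∀ q, Module R (F q)] [∀ q, Module.Free R (F q)]
    (d : ∀ q, F (q + 1) →ₗ[R] F q) (hd : ∀ q, Function.Exact (d (q + 1)) (d q)) (q : ℕ)
    (hq : n + m ≤ q) (c : F (q + 1) →ₗ[R] S) (hc : c ∘ₗ d (q + 1) = 0) :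
    ∃ c' : F q →ₗ[R] S, c' ∘ₗ d q = c := by
  have hd' : ∀ q ≥ n, Function.Exact ((d (q + 1)).baseChange S) ((d q).baseChange S) := by
    intro q hq
    have := FlatDimLE.exact_rTensor d hd n S hn q hq
    rw [LinearMap.rTensor_exact_iff_lTensor_exact] at this
    exact this
  obtain ⟨c', hc'⟩ := InjDimLE.exists_comp_eq (R := S) (G := fun q ↦ S ⊗[R] F q)
    (fun q ↦ (d q).baseChange S) n hd' m S hm q hq (c.liftBaseChange S) (by
      refine TensorProduct.AlgebraTensorModule.ext fun s x ↦ ?_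
      have : c (d (q + 1) x) = 0 := LinearMap.congr_fun hc x
      simp [this])
  refine ⟨c'.restrictScalars R ∘ₗ TensorProduct.mk R S (F q) 1, LinearMap.ext fun x ↦ ?_⟩
  simpa using LinearMap.congr_fun hc' (1 ⊗ₜ x)

lemma FlatDimLE.exists_free_resolution_residueField [IsNoetherianRing R] [IsLocalRing R]
    [IsNoetherianRing S] [IsLocalRing S]
    [IsLocalHom (algebraMap R S)] (n m : ℕ) (hn : FlatDimLE R n S) (hm : InjDimLE S m S) :
    ∃ (F : ℕ → ModuleCat.{0} R) (d : ∀ q, F (q + 1) →ₗ[R] F q)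
      (ε : F 0 →ₗ[R] IsLocalRing.ResidueField R), (∀ q, Module.Free R (F q)) ∧
      Function.Surjective ε ∧ Function.Exact (d 0) ε ∧
      (∀ q, Function.Exact (d (q + 1)) (d q)) ∧ ∀ q, n + m ≤ q →
        ∀ c : F (q + 1) →ₗ[R] R, c ∘ₗ d (q + 1) = 0 → ∃ c' : F q →ₗ[R] R, c' ∘ₗ d q = c := by
  obtain ⟨r, d, ε, hε, hdε, hd⟩ := exists_finite_free_resolution R (IsLocalRing.ResidueField R)
  refine ⟨fun q ↦ ModuleCat.of R (Fin (r q) → R), d, ε, fun q ↦ inferInstanceAs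
    (Module.Free R (Fin (r q) → R)), hε, hdε, hd,
    fun q hq (c : (Fin (r (q + 1)) → R) →ₗ[R] R) (hc : c ∘ₗ d (q + 1) = 0) ↦ ?_⟩
  obtain ⟨β, hβ⟩ := FlatDimLE.exists_comp_eq_of_injDimLE n m hn hm
    (F := fun q ↦ Fin (r q) → R) d hd q hq
    (Algebra.linearMap R S ∘ₗ c) (by
      rw [LinearMap.comp_assoc, hc, LinearMap.comp_zero])
  exact FlatDimLE.exists_comp_eq_of_algebraMap_comp_eq S n hn r d ε hdε hd q c hc β hβ

end BaseChange

section ExtVanishing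

variable {R : Type} [CommRing R]

/-- If `Hom(-, N)` preserves exactness of a projective resolution of `K` in high degrees, then
`Ext^i(K, N)` vanishes for large `i`. -/
lemma subsingleton_ext_of_resolution (N : ModuleCat.{0} R) (p : ℕ) (K : Type) [AddCommGroup K]
    [Module R K] (F : ℕ → ModuleCat.{0} R) (hF : ∀ q, Module.Free R (F q))
    (d : ∀ q, F (q + 1) →ₗ[R] F q) (ε : F 0 →ₗ[R] K) (hε : Function.Surjective ε)
    (hdε : Function.Exact (d 0) ε) (hd : ∀ q, Function.Exact (d (q + 1)) (d q))
    (h : ∀ c : F (p + 1) →ₗ[R] N, c ∘ₗ d (p + 1) = 0 → ∃ c' : F p →ₗ[R] N, c' ∘ₗ d p = c) :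
    Subsingleton (Abelian.Ext.{0} (ModuleCat.of R K) N (p + 1)) := by
  induction p using Nat.strong_induction_on generalizing K F with | _ p ih
  have hproj : ∀ q, Projective (F q) := fun q ↦
    (IsProjective.iff_projective _).1 (Module.Projective.of_free (R := R))
  have hS := LinearMap.shortExact_shortComplexKer hε
  have hP : Projective ε.shortComplexKer.X₂ := hproj 0
  have hsurj := precomp_extClass_surjective_of_projective_X₂ N hS p
  let ε' : F 1 →ₗ[R] LinearMap.ker ε := (d 0).codRestrict _ fun x ↦ hdε.apply_apply_eq_zero x
  have hε' : Function.Surjective ε' := by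
    rintro ⟨x, hx⟩
    obtain ⟨y, rfl⟩ := (hdε x).1 hx
    exact ⟨y, rfl⟩
  have hdε' : Function.Exact (d 1) ε' := by
    intro x
    rw [← hd 0 x]
    exact Subtype.ext_iff
  obtain _ | p := p
  · refine ⟨fun x y ↦ ?_⟩
    suffices ∀ x : Abelian.Ext.{0} (ModuleCat.of R K) N 1, x = 0 by rw [this x, this y]
    intro x
    obtain ⟨y, rfl⟩ := hsurj x
    obtain ⟨f, rfl⟩ := Abelian.Ext.homEquiv₀.symm.surjective y
    obtain ⟨c', hc'⟩ := h (f.hom ∘ₗ ε') (by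
      rw [LinearMap.comp_assoc, hdε'.linearMap_comp_eq_zero, LinearMap.comp_zero])
    have : f = ε.shortComplexKer.f ≫ ModuleCat.ofHom c' := by
      ext x
      obtain ⟨y, rfl⟩ := hε' x
      exact (LinearMap.congr_fun hc' y).symm
    subst this
    have : Abelian.Ext.mk₀ (ε.shortComplexKer.f ≫ ModuleCat.ofHom c') =
        (Abelian.Ext.mk₀ ε.shortComplexKer.f).comp (Abelian.Ext.mk₀ (ModuleCat.ofHom c'))
          (add_zero 0) := by simp
    change hS.extClass.comp (Abelian.Ext.mk₀ _) (add_comm 1 0) = 0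
    rw [this, hS.extClass_comp_assoc]
  · have := ih p p.lt_succ_self (LinearMap.ker ε) (fun q ↦ F (q + 1)) (fun q ↦ hF (q + 1))
      (fun q ↦ d (q + 1)) ε' hε' hdε' (fun q ↦ hd (q + 1)) h
    have : Subsingleton (Abelian.Ext.{0} ε.shortComplexKer.X₁ N (p + 1)) := this
    exact hsurj.subsingleton

end ExtVanishing

section FiniteModules

variable {R : Type} [CommRing R]

lemma subsingleton_ext_of_exact {A B C : Type} [AddCommGroup A] [Module R A] [AddCommGroup B]
    [Module R B] [AddCommGroup C] [Module R C] (f : A →ₗ[R] B) (g : B →ₗ[R] C)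
    (hf : Function.Injective f) (hg : Function.Surjective g) (hfg : Function.Exact f g)
    (N : ModuleCat.{0} R) (i : ℕ) (hA : Subsingleton (Abelian.Ext.{0} (ModuleCat.of R A) N i))
    (hC : Subsingleton (Abelian.Ext.{0} (ModuleCat.of R C) N i)) :
    Subsingleton (Abelian.Ext.{0} (ModuleCat.of R B) N i) := by
  have hS := ModuleCat.shortComplex_shortExact (ModuleCat.shortComplexOfCompEqZero f g
    hfg.linearMap_comp_eq_zero) hfg hf hg
  refine ⟨fun x y ↦ ?_⟩
  rw [← sub_eq_zero]
  obtain ⟨z, hz⟩ := Abelian.Ext.contravariant_sequence_exact₂ hS N (x - y) (hA.elim _ _)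
  rw [← hz, hC.elim z 0, Abelian.Ext.comp_zero]

lemma subsingleton_ext_of_linearEquiv {A B : Type} [AddCommGroup A] [Module R A] [AddCommGroup B]
    [Module R B] (e : A ≃ₗ[R] B) (N : ModuleCat.{0} R) (i : ℕ)
    (hB : Subsingleton (Abelian.Ext.{0} (ModuleCat.of R B) N i)) :
    Subsingleton (Abelian.Ext.{0} (ModuleCat.of R A) N i) := by
  refine ⟨fun x y ↦ ?_⟩
  have h (z : Abelian.Ext.{0} (ModuleCat.of R A) N i) : (Abelian.Ext.mk₀ e.toModuleIso.hom).comp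
      ((Abelian.Ext.mk₀ e.toModuleIso.inv).comp z (zero_add i)) (zero_add i) = z := by
    rw [Abelian.Ext.mk₀_comp_mk₀_assoc, Iso.hom_inv_id, Abelian.Ext.mk₀_id_comp]
  rw [← h x, ← h y]
  congr 1
  exact hB.elim _ _

lemma subsingleton_ext_quotient_of_sup_span [IsNoetherianRing R] [IsLocalRing R]
    (N : ModuleCat.{0} R) [Module.Finite R N] (p : Ideal R) [p.IsPrime] (x : R)
    (hx : x ∈ IsLocalRing.maximalIdeal R) (hxp : x ∉ p) (i : ℕ)
    (h : ∀ (C : Type) [AddCommGroup C] [Module R C] [Module.Finite R C],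
      p ⊔ Ideal.span {x} ≤ Module.annihilator R C →
        Subsingleton (Abelian.Ext.{0} (ModuleCat.of R C) N (i + 1))) :
    Subsingleton (Abelian.Ext.{0} (ModuleCat.of R (R ⧸ p)) N i) := by
  let f : (R ⧸ p) →ₗ[R] (R ⧸ p) := x • LinearMap.id
  have hf : Function.Injective f := by
    rw [injective_iff_map_eq_zero]
    intro y hy
    obtain ⟨y, rfl⟩ := Ideal.Quotient.mk_surjective y
    have : Ideal.Quotient.mk p (x * y) = 0 := hy
    rw [Ideal.Quotient.eq_zero_iff_mem] at this ⊢
    exact (Ideal.IsPrime.mem_or_mem ‹_› this).resolve_left hxp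
  have hfg := LinearMap.exact_map_mkQ_range f
  have hS := ModuleCat.shortComplex_shortExact (ModuleCat.shortComplexOfCompEqZero f _
    hfg.linearMap_comp_eq_zero) hfg hf (Submodule.mkQ_surjective _)
  have hC : Subsingleton (Abelian.Ext.{0} (ModuleCat.of R ((R ⧸ p) ⧸ LinearMap.range f)) N
      (i + 1)) := by
    refine h _ (sup_le (fun a ha ↦ ?_) ((Ideal.span_singleton_le_iff_mem _).2 ?_))
    · refine Module.mem_annihilator.2 fun y ↦ ?_
      obtain ⟨y, rfl⟩ := Submodule.mkQ_surjective _ y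
      obtain ⟨y, rfl⟩ := Ideal.Quotient.mk_surjective y
      rw [← map_smul]
      have : a • Ideal.Quotient.mk p y = Ideal.Quotient.mk p (a * y) := rfl
      rw [this, Ideal.Quotient.eq_zero_iff_mem.2 (p.mul_mem_right _ ha), map_zero]
    · refine Module.mem_annihilator.2 fun y ↦ ?_
      obtain ⟨y, rfl⟩ := Submodule.mkQ_surjective _ y
      rw [← map_smul]
      exact (Submodule.Quotient.mk_eq_zero _).2 ⟨y, rfl⟩
  have key (y : Abelian.Ext.{0} (ModuleCat.of R (R ⧸ p)) N i) : ∃ z, x • z = y := by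
    obtain ⟨z, hz⟩ := Abelian.Ext.contravariant_sequence_exact₁ hS N y (add_comm 1 i)
      (hC.elim _ _)
    refine ⟨z, ?_⟩
    rw [← hz]
    change _ = (Abelian.Ext.mk₀ (x • 𝟙 (ModuleCat.of R (R ⧸ p)))).comp z _
    rw [Abelian.Ext.mk₀_smul, Abelian.Ext.smul_comp, Abelian.Ext.mk₀_id_comp]
  have := Submodule.eq_bot_of_le_smul_of_le_jacobson_bot (IsLocalRing.maximalIdeal R)
    (⊤ : Submodule R (Abelian.Ext.{0} (ModuleCat.of R (R ⧸ p)) N i)) Module.Finite.fg_top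
    (fun y _ ↦ by
      obtain ⟨z, rfl⟩ := key y
      exact Submodule.smul_mem_smul hx trivial) (IsLocalRing.maximalIdeal_le_jacobson _)
  exact (Submodule.subsingleton_iff R).1 (subsingleton_of_bot_eq_top this.symm)

/-- Over a noetherian local ring, vanishing of `Ext^i(k, N)` for large `i` implies vanishing of
`Ext^i(M, N)` for all finite modules `M`. -/
lemma subsingleton_ext_of_residueField [IsNoetherianRing R] [IsLocalRing R]
    (N : ModuleCat.{0} R) [Module.Finite R N] (n : ℕ)
    (h : ∀ i, n < i →
      Subsingleton (Abelian.Ext.{0} (ModuleCat.of R (IsLocalRing.ResidueField R)) N i))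
    (M : Type) [AddCommGroup M] [Module R M] [Module.Finite R M] (i : ℕ) (hi : n < i) :
    Subsingleton (Abelian.Ext.{0} (ModuleCat.of R M) N i) := by
  suffices ∀ (I : Ideal R) (M : Type) [AddCommGroup M] [Module R M] [Module.Finite R M],
      I ≤ Module.annihilator R M → ∀ i, n < i →
        Subsingleton (Abelian.Ext.{0} (ModuleCat.of R M) N i) from this ⊥ M bot_le i hi
  intro I
  induction I using IsNoetherian.induction with | _ I ih
  intro M _ _ _
  refine IsNoetherianRing.induction_on_isQuotientEquivQuotientPrime R (M := M) inferInstance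
    (motive := fun M _ _ _ ↦ I ≤ Module.annihilator R M → ∀ i, n < i →
        Subsingleton (Abelian.Ext.{0} (ModuleCat.of R M) N i)) ?_ ?_ ?_
  · intro M _ _ _ _ _ i _
    refine ⟨fun x y ↦ ?_⟩
    have h (z : Abelian.Ext.{0} (ModuleCat.of R M) N i) : z = 0 := by
      rw [← Abelian.Ext.mk₀_id_comp z,
        (ModuleCat.isZero_of_subsingleton (ModuleCat.of R M)).eq_of_src (𝟙 _) 0]
      simp
    rw [h x, h y]
  · intro M _ _ _ p e hI i hi
    refine subsingleton_ext_of_linearEquiv e N i ?_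
    rw [e.annihilator_eq, Ideal.annihilator_quotient] at hI
    obtain rfl | hI := hI.eq_or_lt
    · obtain hp | ⟨x, hx, hxp⟩ : p.1 = IsLocalRing.maximalIdeal R ∨
          ∃ x ∈ IsLocalRing.maximalIdeal R, x ∉ p.1 := by
        by_cases hp : IsLocalRing.maximalIdeal R ≤ p.1
        · exact .inl ((IsLocalRing.le_maximalIdeal p.2.ne_top).antisymm hp)
        · exact .inr (Set.not_subset.1 hp)
      · rw [hp]
        exact h i hi
      · have := p.2
        exact subsingleton_ext_quotient_of_sup_span N p.1 x hx hxp i fun C _ _ _ hC ↦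
          ih _ (lt_of_le_of_ne le_sup_left fun he ↦ hxp (he ▸ Ideal.mem_sup_right
            (Ideal.mem_span_singleton_self x))) C hC (i + 1) (by omega)
    · exact ih p.1 hI _ Ideal.annihilator_quotient.ge i hi
  · intro A _ _ _ B _ _ _ C _ _ _ f g hf hg hfg hA hC hI i hi
    exact subsingleton_ext_of_exact f g hf hg hfg N i
      (hA (hI.trans (LinearMap.annihilator_le_of_injective f hf)) i hi)
      (hC (hI.trans (LinearMap.annihilator_le_of_surjective g hg)) i hi)

lemma baer_of_subsingleton_ext_one (N : ModuleCat.{0} R)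
    (h : ∀ I : Ideal R, Subsingleton (Abelian.Ext.{0} (ModuleCat.of R (R ⧸ I)) N 1)) :
    Module.Baer R N := by
  intro I g
  have hfg := LinearMap.exact_subtype_mkQ I
  have hS := ModuleCat.shortComplex_shortExact (ModuleCat.shortComplexOfCompEqZero _ _
    hfg.linearMap_comp_eq_zero) hfg I.subtype_injective (Submodule.mkQ_surjective _)
  obtain ⟨φ, hφ⟩ := Abelian.Ext.contravariant_sequence_exact₁ hS N
    (Abelian.Ext.mk₀ (ModuleCat.ofHom g)) (add_zero 1) ((h I).elim _ _)
  obtain ⟨φ, rfl⟩ := Abelian.Ext.homEquiv₀.symm.surjective φ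
  have : _ ≫ φ = ModuleCat.ofHom g := Abelian.Ext.homEquiv₀.symm.injective (by simpa using hφ)
  exact ⟨φ.hom, fun x hx ↦ LinearMap.congr_fun (congr_arg ModuleCat.Hom.hom this) ⟨x, hx⟩⟩

lemma hasInjectiveDimensionLT_of_finite (N : ModuleCat.{0} R) (n : ℕ)
    (h : ∀ (M : Type) [AddCommGroup M] [Module R M] [Module.Finite R M],
      Subsingleton (Abelian.Ext.{0} (ModuleCat.of R M) N (n + 1))) :
    HasInjectiveDimensionLT N (n + 1) := by
  induction n generalizing N with
  | zero =>
    rw [zero_add, ← injective_iff_hasInjectiveDimensionLT_one,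
      ← Module.injective_iff_injective_object, ← Module.Baer.iff_injective]
    exact baer_of_subsingleton_ext_one N fun I ↦ h (R ⧸ I)
  | succ n ih =>
    let S := ShortComplex.mk _ _ (Limits.cokernel.condition (Injective.ι N))
    have hS : S.ShortExact := { exact := ShortComplex.exact_cokernel _ }
    have hI : Injective S.X₂ := inferInstanceAs (Injective (Injective.under N))
    refine (hS.hasInjectiveDimensionLT_X₃_iff n hI).1 (ih S.X₃ fun M _ _ _ ↦ ⟨fun x y ↦ ?_⟩)
    rw [← sub_eq_zero]
    obtain ⟨z, hz⟩ := Abelian.Ext.covariant_sequence_exact₃ (ModuleCat.of R M) hS (x - y) rfl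
      ((h M).elim _ _)
    rw [← hz, Abelian.Ext.eq_zero_of_injective z, Abelian.Ext.zero_comp]

end FiniteModules

/-- Descent of the Gorenstein property along a local homomorphism of finite flat
dimension. -/
theorem gorenstein_descent_of_finite_flat_dimension
    (R S : Type) [CommRing R] [CommRing S] [IsNoetherianRing R] [IsNoetherianRing S]
    [IsLocalRing R] [IsLocalRing S] [Algebra R S]
    [IsLocalHom (algebraMap R S)]
    (hffd : HasFiniteFlatDimension R (ModuleCat.of R S))
    (hS : IsGorenstein S) :
    IsGorenstein R := by
  obtain ⟨n, hn⟩ := hffd.exists_flatDimLE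
  obtain ⟨m, hm⟩ := isGorenstein_iff_exists_hasInjectiveDimensionLT.1 hS
  have := hasInjectiveDimensionLT_of_ge (ModuleCat.of S S) m (m + 1) m.le_succ
  have hm' : InjDimLE S m S := injDimLE_of_hasInjectiveDimensionLT m (ModuleCat.of S S)
  obtain ⟨F, d, ε, hF, hε, hdε, hd, h⟩ :=
    FlatDimLE.exists_free_resolution_residueField n m hn hm'
  refine isGorenstein_iff_exists_hasInjectiveDimensionLT.2 ⟨n + m + 1,
    hasInjectiveDimensionLT_of_finite _ (n + m) fun M _ _ _ ↦ ?_⟩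
  refine subsingleton_ext_of_residueField _ (n + m) (fun i hi ↦ ?_) M (n + m + 1)
    (Nat.lt_succ_self _)
  obtain ⟨i, rfl⟩ : ∃ j, i = j + 1 := ⟨i - 1, by omega⟩
  exact subsingleton_ext_of_resolution (ModuleCat.of R R) i _ F hF d ε hε hdε hd
    (h i (Nat.lt_succ_iff.1 hi))
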